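/- Let P ⊆ ℝ^d be a lattice polytope of dimension r ≥ 2. Then the lower limit of the fraction of coprime lattice points satisfies liminf_{n→∞} CE(P;n)/E(P;n) = 1/ζ(r), where ζ is the Riemann zeta function. -/

import Mathlib

open Pointwise

/-- The coercion of an integer vector to a real vector. -/
def ic {d : ℕ} (a : Fin d → ℤ) : Fin d → ℝ := fun i => (a i : ℝ)

/-- The Ehrhart counting function `E(P;n) = |nP ∩ ℤ^d|`. -/
noncomputable def ehr {d : ℕ} (P : Set (Fin d → ℝ)) (n : ℕ) : ℕ :=
  Set.ncard {a : Fin d → ℤ | ic a ∈ (n : ℝ) • P}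

/-- The coprime Ehrhart function
`CE(P;n) = |{a ∈ nP ∩ ℤ^d : gcd(a_1,…,a_d,n) = 1}|`. -/
noncomputable def CE {d : ℕ} (P : Set (Fin d → ℝ)) (n : ℕ) : ℕ :=
  Set.ncard {a : Fin d → ℤ | ic a ∈ (n : ℝ) • P ∧
    Int.gcd (Finset.univ.gcd a) (n : ℤ) = 1}

open Filter Topology MeasureTheory

lemma ic_inj {d : ℕ} : Function.Injective (ic (d := d)) := by
  intro a b h
  funext i
  have := congrFun h i
  simpa [ic] using this

lemma mem_Zspan {d : ℕ} (x : Fin d → ℝ) :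
    x ∈ Submodule.span ℤ (Set.range (Pi.basisFun ℝ (Fin d))) ↔ ∃ a : Fin d → ℤ, ic a = x := by
  rw [Module.Basis.mem_span_iff_repr_mem]
  simp only [Pi.basisFun_repr, Set.mem_range]
  constructor
  · intro h
    choose a ha using h
    exact ⟨a, by funext i; simpa [ic] using ha i⟩
  · rintro ⟨a, rfl⟩ i
    exact ⟨a i, by simp [ic]⟩

lemma ehr_asymp {d r : ℕ} (P : Set (Fin d → ℝ))
    (hP : ∃ V : Finset (Fin d → ℤ), V.Nonempty ∧ P = convexHull ℝ (ic '' ↑V))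
    (hdim : Module.finrank ℝ (affineSpan ℝ P).direction = r) :
    ∃ c : ℝ, 0 < c ∧ Tendsto (fun n : ℕ => (ehr P n : ℝ) / (n : ℝ) ^ r) atTop (𝓝 c) := by
  obtain ⟨V, ⟨v0, hv0⟩, hPV⟩ := hP
  have hcpt : IsCompact P := by
    rw [hPV]; exact (V.finite_toSet.image _).isCompact_convexHull ℝ
  have hconv : Convex ℝ P := by rw [hPV]; exact convex_convexHull _ _
  have hvP : ic v0 ∈ P := by rw [hPV]; exact subset_convexHull _ _ ⟨v0, hv0, rfl⟩
  set W := (affineSpan ℝ P).direction with hW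
  let L : Submodule ℤ W := ZLattice.comap ℝ
    (Submodule.span ℤ (Set.range (Pi.basisFun ℝ (Fin d)))) W.subtype
  have hL : ∀ w : W, w ∈ L ↔ ∃ a : Fin d → ℤ, ic a = (w : Fin d → ℝ) := fun w => mem_Zspan _
  have : DiscreteTopology L := ZLattice.comap_discreteTopology ℝ _
    W.subtypeL.continuous W.injective_subtype
  have hWspan : W = Submodule.span ℝ ((· -ᵥ ic v0) '' (ic '' (V : Set (Fin d → ℤ)))) := by
    rw [hW, hPV, affineSpan_convexHull, direction_affineSpan]
    exact vectorSpan_eq_span_vsub_set_right ℝ (Set.mem_image_of_mem ic hv0)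
  have : IsZLattice ℝ L := by
    constructor
    apply Submodule.map_injective_of_injective W.injective_subtype
    rw [Submodule.map_span, Submodule.map_top, Submodule.range_subtype]
    apply le_antisymm
    · rw [Submodule.span_le]
      rintro _ ⟨w, -, rfl⟩
      exact w.2
    · conv_lhs => rw [hWspan]
      apply Submodule.span_mono
      rintro _ ⟨_, ⟨v, hv, rfl⟩, rfl⟩
      have hmem : ic v -ᵥ ic v0 ∈ W := by
        rw [hWspan]; exact Submodule.subset_span ⟨_, ⟨v, hv, rfl⟩, rfl⟩
      refine ⟨⟨_, hmem⟩, ?_, rfl⟩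
      exact (hL _).2 ⟨v - v0, by funext i; simp [ic]⟩
  let s : Set W := {w | (w : Fin d → ℝ) + ic v0 ∈ P}
  let φ : W →ᵃ[ℝ] (Fin d → ℝ) := W.subtype.toAffineMap + AffineMap.const ℝ W (ic v0)
  have hφ : ∀ w, φ w = (w : Fin d → ℝ) + ic v0 := fun w => by simp [φ]
  have hφc : Continuous φ := by
    have : (φ : W → Fin d → ℝ) = fun w : W => (w : Fin d → ℝ) + ic v0 := funext hφ
    rw [this]; fun_prop
  have hφi : Function.Injective φ := by
    intro a b h
    rw [hφ, hφ] at h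
    exact Subtype.ext (add_right_cancel h)
  have hs : s = φ ⁻¹' P := by ext w; simp [s, hφ]
  have hsP : φ '' s = P := by
    apply Set.Subset.antisymm
    · rw [hs]; exact Set.image_preimage_subset _ _
    · intro x hx
      have hm : x -ᵥ ic v0 ∈ W := AffineSubspace.vsub_mem_direction
        (subset_affineSpan ℝ P hx) (subset_affineSpan ℝ P hvP)
      have : φ ⟨_, hm⟩ = x := by rw [hφ]; simp
      exact ⟨⟨_, hm⟩, by rw [hs, Set.mem_preimage, this]; exact hx, this⟩
  have hsconv : Convex ℝ s := by rw [hs]; exact hconv.affine_preimage φ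
  have hsclosed : IsClosed s := by rw [hs]; exact hcpt.isClosed.preimage hφc
  have hsbdd : Bornology.IsBounded s := by
    obtain ⟨C, hC⟩ := hcpt.isBounded.exists_norm_le
    rw [isBounded_iff_forall_norm_le]
    refine ⟨C + ‖ic v0‖, fun w hw => ?_⟩
    have := hC _ hw
    have h2 := norm_sub_le ((w : Fin d → ℝ) + ic v0) (ic v0)
    rw [add_sub_cancel_right] at h2
    rw [Submodule.coe_norm]
    linarith
  have hsint : (interior s).Nonempty := by
    rw [hsconv.interior_nonempty_iff_affineSpan_eq_top, eq_top_iff]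
    rintro w -
    have h1 : (affineSpan ℝ s).map φ = affineSpan ℝ P := by
      rw [AffineSubspace.map_span, hsP]
    have h2 : φ w ∈ affineSpan ℝ P := by
      rw [hφ, ← vadd_eq_add]
      exact AffineSubspace.vadd_mem_of_mem_direction w.2 (subset_affineSpan ℝ P hvP)
    rw [← h1] at h2
    obtain ⟨y, hy, hyw⟩ := h2
    rw [← hφi hyw]; exact hy
  let b0 := Module.Free.chooseBasis ℤ L
  have hcard : Fintype.card (Module.Free.ChooseBasisIndex ℤ L) = r := by
    rw [← Module.finrank_eq_card_chooseBasisIndex, ZLattice.rank ℝ, hdim]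
  let _ : MeasurableSpace W := borel W
  have : BorelSpace W := ⟨rfl⟩
  let e := (b0.ofZLatticeBasis ℝ).equivFun
  have heconv : Convex ℝ (e '' s) := hsconv.linear_image e.toLinearMap
  have heint : (interior (e '' s)).Nonempty := by
    have := (b0.ofZLatticeBasis ℝ).equivFunL.toHomeomorph.image_interior s
    have h3 := hsint.image ((b0.ofZLatticeBasis ℝ).equivFunL.toHomeomorph)
    rw [this] at h3
    exact h3
  have hecpt : IsCompact (e '' s) := by
    have h1 : IsCompact s := Metric.isCompact_of_isClosed_isBounded hsclosed hsbdd
    exact h1.image (b0.ofZLatticeBasis ℝ).equivFunL.continuous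
  have key := ZLattice.covolume.tendsto_card_div_pow'' b0 hsbdd hsclosed.measurableSet
    (heconv.addHaar_frontier volume)
  refine ⟨_, ?_, key.congr' ?_⟩
  · rw [measureReal_def]
    exact ENNReal.toReal_pos (Measure.measure_pos_of_nonempty_interior _ heint).ne'
      hecpt.measure_lt_top.ne
  · filter_upwards [eventually_gt_atTop 0] with n hn
    have hn0 : (n : ℝ) ≠ 0 := by positivity
    rw [hcard]
    congr 2
    rw [Nat.card_coe_set_eq, ehr, ← Set.ncard_image_of_injective _ ic_inj,
      ← Set.ncard_image_of_injective (f := fun w => (n : ℝ) • φ w) _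
        ((smul_right_injective _ hn0).comp hφi)]
    congr 1
    ext x
    constructor
    · rintro ⟨w, ⟨hw, hwL⟩, rfl⟩
      rw [Set.mem_inv_smul_set_iff₀ hn0] at hwL
      obtain ⟨a, ha⟩ := (hL _).1 hwL
      have hh : ic (a + n • v0) = (n : ℝ) • φ w := by
        rw [hφ, smul_add]
        have : ic (a + n • v0) = ic a + (n : ℝ) • ic v0 := by funext i; simp [ic]
        rw [this, ha]; rfl
      refine ⟨a + n • v0, ?_, hh⟩
      rw [Set.mem_ofPred_eq, hh]
      exact Set.smul_mem_smul_set (by rw [hφ]; exact hw)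
    · rintro ⟨a, ha, rfl⟩
      obtain ⟨p, hp, hpa⟩ := ha
      rw [← hsP] at hp
      obtain ⟨w, hw, rfl⟩ := hp
      refine ⟨w, ⟨hw, ?_⟩, hpa⟩
      rw [Set.mem_inv_smul_set_iff₀ hn0]
      refine (hL _).2 ⟨a - n • v0, ?_⟩
      have : ic (a - n • v0) = ic a - (n : ℝ) • ic v0 := by funext i; simp [ic]
      rw [this, ← hpa]
      simp [hφ]

lemma ehr_finite {d : ℕ} {P : Set (Fin d → ℝ)} (hP : Bornology.IsBounded P) (n : ℕ) :
    {a : Fin d → ℤ | ic a ∈ (n : ℝ) • P}.Finite := by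
  obtain ⟨C, hC⟩ := (hP.smul₀ (n : ℝ)).exists_norm_le
  refine (Set.finite_Icc (fun _ : Fin d => -⌈C⌉) (fun _ => ⌈C⌉)).subset ?_
  intro a ha
  have h1 := hC _ ha
  have h2 : ∀ i, |(a i : ℝ)| ≤ C := fun i => (norm_le_pi_norm (ic a) i).trans h1
  have h3 : ∀ i, |a i| ≤ ⌈C⌉ := fun i => by
    have := (h2 i).trans (Int.le_ceil C)
    exact_mod_cast this
  exact ⟨fun i => (abs_le.1 (h3 i)).1, fun i => (abs_le.1 (h3 i)).2⟩

lemma gcd_smul {d : ℕ} (a : Fin d → ℤ) (m k : ℕ) :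
    Int.gcd (Finset.univ.gcd (m • a)) ((m * k : ℕ) : ℤ)
      = m * Int.gcd (Finset.univ.gcd a) (k : ℤ) := by
  have h : Finset.univ.gcd (m • a) = (m : ℤ) * Finset.univ.gcd a := by
    have := Finset.gcd_mul_left (s := Finset.univ) (f := a) (a := (m : ℤ))
    rw [Int.normalize_of_nonneg (by positivity)] at this
    rw [← this]
    congr 1
  rw [h, Nat.cast_mul, Int.gcd_mul_left, Int.natAbs_natCast]

lemma sum_CE {d : ℕ} {P : Set (Fin d → ℝ)} (hP : Bornology.IsBounded P) (n : ℕ) (hn : 0 < n) :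
    ∑ k ∈ n.divisors, CE P k = ehr P n := by
  classical
  rw [ehr, Set.ncard_eq_toFinset_card _ (ehr_finite hP n),
    Finset.card_eq_sum_card_fiberwise (t := n.divisors)
      (f := fun a => n / Int.gcd (Finset.univ.gcd a) (n : ℤ))]
  · refine Finset.sum_congr rfl fun k hk => ?_
    obtain ⟨m, rfl⟩ := (Nat.dvd_of_mem_divisors hk)
    have hk0 : 0 < k := Nat.pos_of_mem_divisors hk
    have hm0 : 0 < m := Nat.pos_of_mul_pos_left hn
    have hmR : (m : ℝ) ≠ 0 := by positivity
    have hinj : Function.Injective (fun a : Fin d → ℤ => m • a) := by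
      intro a b h
      funext i
      have := congrFun h i
      simpa [hm0.ne'] using this
    have hic : ∀ a : Fin d → ℤ, ic (m • a) = (m : ℝ) • ic a := fun a => by
      funext i; simp [ic]
    have hmem : ∀ a : Fin d → ℤ, ic (m • a) ∈ ((k * m : ℕ) : ℝ) • P ↔ ic a ∈ (k : ℝ) • P := by
      intro a
      rw [hic, Nat.cast_mul, mul_comm, mul_smul, Set.smul_mem_smul_set_iff₀ hmR]
    rw [CE, ← Set.ncard_image_of_injective _ hinj, ← Set.ncard_coe_finset]
    congr 1
    ext x
    simp only [Set.mem_image, Set.mem_ofPred_eq, Finset.coe_filter, Set.Finite.mem_toFinset]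
    constructor
    · rintro ⟨a, ⟨ha, hg⟩, rfl⟩
      refine ⟨(hmem a).2 ha, ?_⟩
      rw [mul_comm k m, gcd_smul, hg, mul_one, Nat.mul_div_cancel_left _ hm0]
    · rintro ⟨hx, hg⟩
      have hgd : Int.gcd (Finset.univ.gcd x) ((k * m : ℕ) : ℤ) ∣ k * m := by
        have := Int.gcd_dvd_right (Finset.univ.gcd x) ((k * m : ℕ) : ℤ)
        exact_mod_cast this
      have hgm : Int.gcd (Finset.univ.gcd x) ((k * m : ℕ) : ℤ) = m := by
        have := Nat.div_mul_cancel hgd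
        rw [hg] at this
        exact Nat.eq_of_mul_eq_mul_left hk0 this
      have hdiv : ∀ i, (m : ℤ) ∣ x i := fun i => by
        have h1 : (m : ℤ) ∣ Finset.univ.gcd x := by
          have := Int.gcd_dvd_left (Finset.univ.gcd x) ((k * m : ℕ) : ℤ)
          rwa [hgm] at this
        exact h1.trans (Finset.gcd_dvd (Finset.mem_univ i))
      choose a ha using hdiv
      have hxa : m • a = x := by funext i; simp [ha i]
      subst hxa
      refine ⟨a, ⟨(hmem a).1 hx, ?_⟩, rfl⟩
      rw [mul_comm k m, gcd_smul] at hgm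
      exact Nat.eq_of_mul_eq_mul_left hm0 (by rw [hgm, mul_one])
  · intro a _
    have hgd : Int.gcd (Finset.univ.gcd a) (n : ℤ) ∣ n := by
      have := Int.gcd_dvd_right (Finset.univ.gcd a) (n : ℤ)
      exact_mod_cast this
    simp only [Finset.mem_coe, Nat.mem_divisors]
    exact ⟨Nat.div_dvd_of_dvd hgd, hn.ne'⟩

lemma CE_eq {d : ℕ} {P : Set (Fin d → ℝ)} (hP : Bornology.IsBounded P) (n : ℕ) (hn : 0 < n) :
    (CE P n : ℝ) = ∑ k ∈ n.divisors, (ArithmeticFunction.moebius k : ℝ) * (ehr P (n / k) : ℝ) := by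
  have := (ArithmeticFunction.sum_eq_iff_sum_mul_moebius_eq
    (f := fun n => (CE P n : ℝ)) (g := fun n => (ehr P n : ℝ))).1
    (fun n hn => by rw [← sum_CE hP n hn]; push_cast; rfl) n hn
  rw [← this, Nat.sum_divisorsAntidiagonal
    (f := fun i j => (ArithmeticFunction.moebius i : ℝ) * (ehr P j : ℝ))]

/-- The divisor sum `∑_{k ∣ n} μ(k) k^{-r}`. -/
noncomputable def Mf (r n : ℕ) : ℝ :=
  ∑ k ∈ n.divisors, (ArithmeticFunction.moebius k : ℝ) * (1 / (k : ℝ) ^ r)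

lemma Mf_eq {r n : ℕ} (hn : n ≠ 0) :
    Mf r n = ∏ p ∈ n.primeFactors, (1 - 1 / (p : ℝ) ^ r) := by
  rw [Mf]
  have h1 : ∑ k ∈ n.divisors, (ArithmeticFunction.moebius k : ℝ) * (1 / (k : ℝ) ^ r)
      = ∑ k ∈ n.divisors with Squarefree k,
        (ArithmeticFunction.moebius k : ℝ) * (1 / (k : ℝ) ^ r) := by
    rw [Finset.sum_filter]
    refine Finset.sum_congr rfl fun k _ => ?_
    split_ifs with h
    · rfl
    · rw [ArithmeticFunction.moebius_eq_zero_of_not_squarefree h]; simp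
  have h2 : {k ∈ n.divisors | Squarefree k} = (UniqueFactorizationMonoid.radical n).divisors := by
    ext k
    rw [Finset.mem_filter, Nat.mem_divisors, Nat.mem_divisors]
    constructor
    · rintro ⟨⟨h, _⟩, hs⟩
      exact ⟨(UniqueFactorizationMonoid.dvd_radical_iff hs.isRadical hn).2 h,
        UniqueFactorizationMonoid.radical_ne_zero⟩
    · rintro ⟨h, _⟩
      exact ⟨⟨h.trans UniqueFactorizationMonoid.radical_dvd_self, hn⟩,
        UniqueFactorizationMonoid.squarefree_radical.squarefree_of_dvd h⟩
  let f : ArithmeticFunction ℝ := ⟨fun k => if k = 0 then 0 else 1 / (k : ℝ) ^ r, by simp⟩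
  have hf : ∀ k, k ≠ 0 → f k = 1 / (k : ℝ) ^ r := fun k hk => by
    change (if k = 0 then (0 : ℝ) else 1 / (k : ℝ) ^ r) = _
    rw [if_neg hk]
  have hfm : f.IsMultiplicative := by
    rw [ArithmeticFunction.IsMultiplicative.iff_ne_zero]
    refine ⟨by rw [hf 1 one_ne_zero]; simp, fun {a b} ha hb _ => ?_⟩
    rw [hf _ ha, hf _ hb, hf _ (mul_ne_zero ha hb)]
    push_cast
    rw [mul_pow, one_div_mul_one_div]
  have h3 := ArithmeticFunction.IsMultiplicative.prodPrimeFactors_one_sub_of_squarefree f hfm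
    (n := UniqueFactorizationMonoid.radical n) UniqueFactorizationMonoid.squarefree_radical
  rw [h1, h2]
  have h4 : (UniqueFactorizationMonoid.radical n).primeFactors = n.primeFactors := by
    rw [Nat.radical_eq_prod_primeFactors, Nat.primeFactors_prod]
    exact fun p hp => Nat.prime_of_mem_primeFactors hp
  rw [h4] at h3
  calc _ = ∑ k ∈ (UniqueFactorizationMonoid.radical n).divisors,
        (ArithmeticFunction.moebius k : ℝ) * f k :=
        Finset.sum_congr rfl fun k hk => by rw [hf k (Nat.pos_of_mem_divisors hk).ne']
    _ = _ := h3.symm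
    _ = _ := Finset.prod_congr rfl fun p hp => by
        rw [hf p (Nat.prime_of_mem_primeFactors hp).ne_zero]

lemma err_tendsto {d r : ℕ} (hr : 2 ≤ r) {P : Set (Fin d → ℝ)} (hP : Bornology.IsBounded P)
    {c : ℝ} (hc : Tendsto (fun n : ℕ => (ehr P n : ℝ) / (n : ℝ) ^ r) atTop (𝓝 c)) :
    Tendsto (fun n : ℕ => (CE P n : ℝ) / (n : ℝ) ^ r - c * Mf r n) atTop (𝓝 0) := by
  set e : ℕ → ℝ := fun n => (ehr P n : ℝ) / (n : ℝ) ^ r with he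
  obtain ⟨C, hC⟩ : ∃ C, ∀ m, |e m - c| ≤ C := by
    have h1 : Tendsto (fun n => e n - c) atTop (𝓝 0) := by simpa using hc.sub_const c
    obtain ⟨C, hC⟩ := (Metric.isBounded_range_of_tendsto _ h1).exists_norm_le
    exact ⟨C, fun m => hC _ ⟨m, rfl⟩⟩
  let F : ℕ → ℕ → ℝ := fun n k => if k ∣ n then
    (ArithmeticFunction.moebius k : ℝ) * (1 / (k : ℝ) ^ r) * (e (n / k) - c) else 0
  have hF : ∀ n k, |F n k| ≤ 1 / (k : ℝ) ^ r * |e (n / k) - c| := by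
    intro n k
    have h0 : 0 ≤ 1 / (k : ℝ) ^ r * |e (n / k) - c| := by positivity
    simp only [F]
    split_ifs
    · have hmu : |(ArithmeticFunction.moebius k : ℝ)| ≤ 1 := by
        exact_mod_cast ArithmeticFunction.abs_moebius_le_one (n := k)
      rw [abs_mul, abs_mul, abs_of_nonneg (a := 1 / (k : ℝ) ^ r) (by positivity), mul_assoc]
      exact mul_le_of_le_one_left h0 hmu
    · simpa using h0
  have hsum : Summable (fun k : ℕ => 1 / (k : ℝ) ^ r * C) :=
    (Real.summable_one_div_nat_pow.2 (by omega)).mul_right C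
  have key : Tendsto (fun n => ∑' k, F n k) atTop (𝓝 (∑' _ : ℕ, (0 : ℝ))) := by
    refine tendsto_tsum_of_dominated_convergence hsum ?_ ?_
    · intro k
      rcases Nat.eq_zero_or_pos k with rfl | hk
      · have : ∀ n, F n 0 = 0 := fun n => by
          have := hF n 0
          rw [Nat.cast_zero, zero_pow (by omega)] at this
          simpa using this
        simp [this]
      · have h1 : Tendsto (fun n : ℕ => 1 / (k : ℝ) ^ r * |e (n / k) - c|) atTop (𝓝 0) := by
          have h2 : Tendsto (fun n : ℕ => e (n / k)) atTop (𝓝 c) :=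
            hc.comp (Nat.tendsto_div_const_atTop hk.ne')
          have h3 := ((h2.sub_const c).abs).const_mul (1 / (k : ℝ) ^ r)
          simpa using h3
        exact squeeze_zero_norm (fun n => hF n k) h1
    · refine Eventually.of_forall fun n k => (hF n k).trans ?_
      exact mul_le_mul_of_nonneg_left (hC _) (by positivity)
  rw [tsum_zero] at key
  refine key.congr' ?_
  filter_upwards [eventually_gt_atTop 0] with n hn
  rw [tsum_eq_sum (s := n.divisors), CE_eq hP n hn, Mf, Finset.sum_div, Finset.mul_sum,
    ← Finset.sum_sub_distrib]
  · refine Finset.sum_congr rfl fun k hk => ?_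
    obtain ⟨m, rfl⟩ := (Nat.dvd_of_mem_divisors hk)
    have hk0 : 0 < k := Nat.pos_of_mem_divisors hk
    have hm0 : 0 < m := Nat.pos_of_mul_pos_left hn
    simp only [F, e, dvd_mul_right, if_true, Nat.mul_div_cancel_left _ hk0]
    push_cast
    rw [mul_pow]
    field_simp
  · intro k hk
    have : ¬ k ∣ n := fun h => hk (Nat.mem_divisors.2 ⟨h, hn.ne'⟩)
    simp [F, this]

lemma prod_tendsto {r : ℕ} (hr : 2 ≤ r) : ∃ Z : ℝ, (Z : ℂ) = 1 / riemannZeta (r : ℂ) ∧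
    Tendsto (fun n : ℕ => ∏ p ∈ n.primesBelow, (1 - 1 / (p : ℝ) ^ r)) atTop (𝓝 Z) := by
  have hre : 1 < (r : ℂ).re := by rw [Complex.natCast_re]; exact_mod_cast (by omega : 1 < r)
  have h := (riemannZeta_eulerProduct hre).inv₀ (riemannZeta_ne_zero_of_one_lt_re hre)
  have h1 : Tendsto (fun n : ℕ => ((∏ p ∈ n.primesBelow, (1 - 1 / (p : ℝ) ^ r) : ℝ) : ℂ)) atTop
      (𝓝 (riemannZeta (r : ℂ))⁻¹) := by
    refine h.congr fun n => ?_
    rw [← Finset.prod_inv_distrib]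
    push_cast
    refine Finset.prod_congr rfl fun p _ => ?_
    rw [inv_inv, Complex.cpow_neg, Complex.cpow_natCast, one_div]
  have h2 := (Complex.continuous_re.tendsto _).comp h1
  refine ⟨_, ?_, h2.congr fun n => Complex.ofReal_re _⟩
  have h3 := (Complex.continuous_ofReal.tendsto _).comp h2
  rw [one_div]
  refine tendsto_nhds_unique (h3.congr fun n => ?_) h1
  simp only [Function.comp, Complex.ofReal_re]

lemma factor_bounds {r p : ℕ} (hp : p.Prime) :
    0 ≤ (1 - 1 / (p : ℝ) ^ r) ∧ (1 - 1 / (p : ℝ) ^ r) ≤ 1 := by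
  have h1 : (1 : ℝ) ≤ (p : ℝ) ^ r := one_le_pow₀ (by exact_mod_cast hp.one_le)
  have h2 : 1 / (p : ℝ) ^ r ≤ 1 := (div_le_one (by positivity)).2 h1
  have h3 : 0 ≤ 1 / (p : ℝ) ^ r := by positivity
  constructor <;> linarith

lemma Mf_ge {r n N : ℕ} (hn : n ≠ 0) (hN : n < N) :
    ∏ p ∈ N.primesBelow, (1 - 1 / (p : ℝ) ^ r) ≤ Mf r n := by
  rw [Mf_eq hn]
  refine Finset.prod_le_prod_of_subset_of_le_one ?_ ?_ ?_
  · intro p hp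
    rw [Nat.mem_primesBelow]
    exact ⟨(Nat.le_of_mem_primeFactors hp).trans_lt hN, Nat.prime_of_mem_primeFactors hp⟩
  · intro p hp; exact (factor_bounds (Nat.prime_of_mem_primesBelow hp)).1
  · intro p hp _; exact (factor_bounds (Nat.prime_of_mem_primesBelow hp)).2

lemma Mf_factorial {r N : ℕ} :
    Mf r N.factorial = ∏ p ∈ (N + 1).primesBelow, (1 - 1 / (p : ℝ) ^ r) := by
  rw [Mf_eq N.factorial_ne_zero]
  congr 1
  ext p
  rw [Nat.mem_primesBelow, Nat.mem_primeFactors]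
  constructor
  · rintro ⟨hp, hd, _⟩
    exact ⟨Nat.lt_succ_of_le (hp.dvd_factorial.1 hd), hp⟩
  · rintro ⟨h, hp⟩
    exact ⟨hp, hp.dvd_factorial.2 (Nat.le_of_lt_succ h), N.factorial_ne_zero⟩

lemma Mf_bounds {r n : ℕ} (hn : n ≠ 0) : 0 ≤ Mf r n ∧ Mf r n ≤ 1 := by
  rw [Mf_eq hn]
  exact ⟨Finset.prod_nonneg fun p hp => (factor_bounds (Nat.prime_of_mem_primeFactors hp)).1,
    Finset.prod_le_one (fun p hp => (factor_bounds (Nat.prime_of_mem_primeFactors hp)).1)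
      (fun p hp => (factor_bounds (Nat.prime_of_mem_primeFactors hp)).2)⟩

theorem liminf_coprime_fraction {d r : ℕ} (hr : 2 ≤ r) (P : Set (Fin d → ℝ))
    (hP : ∃ V : Finset (Fin d → ℤ), V.Nonempty ∧ P = convexHull ℝ (ic '' ↑V))
    (hdim : Module.finrank ℝ (affineSpan ℝ P).direction = r) :
    ((Filter.liminf (fun n : ℕ => (CE P n : ℝ) / (ehr P n : ℝ)) Filter.atTop : ℝ) : ℂ)
      = 1 / riemannZeta (r : ℂ) := by
  obtain ⟨c, hc0, hc⟩ := ehr_asymp P hP hdim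
  have hbdd : Bornology.IsBounded P := by
    obtain ⟨V, -, rfl⟩ := hP
    exact ((V.finite_toSet.image _).isCompact_convexHull ℝ).isBounded
  obtain ⟨Z, hZ, hprod⟩ := prod_tendsto hr
  rw [← hZ]
  congr 1
  have herr := err_tendsto hr hbdd hc
  have hMZ : ∀ n, n ≠ 0 → Z ≤ Mf r n := fun n hn => by
    refine le_of_tendsto hprod ?_
    filter_upwards [eventually_gt_atTop n] with N hN using Mf_ge hn hN
  have h1 : Tendsto (fun n : ℕ => Mf r n * ((ehr P n : ℝ) / (n : ℝ) ^ r - c)) atTop (𝓝 0) := by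
    have h2 : Tendsto (fun n : ℕ => |(ehr P n : ℝ) / (n : ℝ) ^ r - c|) atTop (𝓝 0) := by
      simpa using (hc.sub_const c).abs
    refine squeeze_zero_norm' ?_ h2
    filter_upwards [eventually_ne_atTop 0] with n hn
    rw [norm_mul, Real.norm_eq_abs, Real.norm_eq_abs, abs_of_nonneg (Mf_bounds hn).1]
    exact mul_le_of_le_one_left (abs_nonneg _) (Mf_bounds hn).2
  have hdiff : Tendsto (fun n : ℕ => (CE P n : ℝ) / (ehr P n : ℝ) - Mf r n) atTop (𝓝 0) := by
    have h3 := (herr.sub h1).div hc hc0.ne'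
    rw [sub_zero, zero_div] at h3
    refine h3.congr' ?_
    filter_upwards [eventually_gt_atTop 0, hc.eventually_ne hc0.ne'] with n hn hne
    have hn0 : (n : ℝ) ≠ 0 := by positivity
    have he0 : (ehr P n : ℝ) ≠ 0 := fun h => hne (by rw [h, zero_div])
    simp only [Pi.div_apply]
    field_simp
    ring
  have hle1 : ∀ n : ℕ, (CE P n : ℝ) / (ehr P n : ℝ) ≤ 1 := fun n => by
    refine div_le_one_of_le₀ ?_ (Nat.cast_nonneg _)
    have h : CE P n ≤ ehr P n :=
      Set.ncard_le_ncard (fun a (ha : _ ∧ _) => ha.1) (ehr_finite hbdd n)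
    exact_mod_cast h
  have hge0 : ∀ n : ℕ, 0 ≤ (CE P n : ℝ) / (ehr P n : ℝ) := fun n => by positivity
  have hB : IsBoundedUnder (· ≥ ·) atTop (fun n : ℕ => (CE P n : ℝ) / (ehr P n : ℝ)) :=
    isBoundedUnder_of ⟨0, hge0⟩
  have hB' : IsBoundedUnder (· ≤ ·) atTop (fun n : ℕ => (CE P n : ℝ) / (ehr P n : ℝ)) :=
    isBoundedUnder_of ⟨1, hle1⟩
  apply le_antisymm
  · refine le_of_forall_pos_le_add fun ε hε => ?_
    refine liminf_le_of_frequently_le ?_ hB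
    have hfac : Tendsto Nat.factorial atTop atTop :=
      tendsto_atTop_mono Nat.self_le_factorial tendsto_id
    have h4 : Tendsto (fun N : ℕ => (CE P N.factorial : ℝ) / (ehr P N.factorial : ℝ)) atTop
        (𝓝 Z) := by
      have h5 : Tendsto (fun N : ℕ => Mf r N.factorial) atTop (𝓝 Z) := by
        simp only [Mf_factorial]
        exact hprod.comp (tendsto_add_atTop_nat 1)
      have h6 := (hdiff.comp hfac).add h5
      rw [zero_add] at h6
      refine h6.congr fun N => ?_
      simp
    have h7 : ∀ᶠ N : ℕ in atTop,
        (CE P N.factorial : ℝ) / (ehr P N.factorial : ℝ) ≤ Z + ε :=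
      (h4.eventually_lt_const (by linarith)).mono fun _ h => h.le
    exact hfac.frequently h7.frequently
  · refine le_of_forall_sub_le fun ε hε => ?_
    refine le_liminf_of_le hB'.isCoboundedUnder_ge ?_
    filter_upwards [hdiff.eventually_const_lt (show -ε < 0 by linarith), eventually_ne_atTop 0]
      with n hn hn0
    have := hMZ n hn0
    linarith
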